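/- arXiv:1905.07003 — 7 statements merged into one kernel-verified Lean document; each statement's English description precedes it below -/
import Mathlib

section
/- Let (X,𝓔) be a coarse space with basepoint x₀ and suppose asdim X ≤ k. Then the coarse free product satisfies asdim(∗X, ∗𝓔) ≤ 2k + 1. -/
open Set

universe u v

/-- Composition of two relations. -/
def rcomp {X : Type u} (E F : Set (X × X)) : Set (X × X) :=
  {p | ∃ y, (p.1, y) ∈ E ∧ (y, p.2) ∈ F}

/-- A collection of subsets of `X × X` is a coarse structure if it contains the diagonal and
is closed under inverses, finite unions, subsets and compositions. -/
def IsCoarseStructure {X : Type u} (𝓔 : Set (Set (X × X))) : Prop :=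
  {p : X × X | p.1 = p.2} ∈ 𝓔 ∧
    (∀ E ∈ 𝓔, Prod.swap '' E ∈ 𝓔) ∧
    (∀ E ∈ 𝓔, ∀ F ∈ 𝓔, E ∪ F ∈ 𝓔) ∧
    (∀ E ∈ 𝓔, ∀ F, F ⊆ E → F ∈ 𝓔) ∧
    (∀ E ∈ 𝓔, ∀ F ∈ 𝓔, rcomp E F ∈ 𝓔)

/-- `compIter E k` is the `k`-fold composition `E ∘ E ∘ ⋯ ∘ E`, with `E^0 = E ∩ Δ`. -/
def compIter {X : Type u} (E : Set (X × X)) : ℕ → Set (X × X)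
  | 0 => E ∩ {p | p.1 = p.2}
  | 1 => E
  | k + 2 => rcomp E (compIter E (k + 1))

/-- `DE E x y = min {k : (x,y) ∈ E^k}`, with value `∞` if there is no such `k`. -/
noncomputable def DE {X : Type u} (E : Set (X × X)) (x y : X) : ℕ∞ :=
  sInf {n : ℕ∞ | ∃ k : ℕ, n = (k : ℕ∞) ∧ (x, y) ∈ compIter E k}

/-- The free product `∗X`: finite words in the alphabet `X \ {x₀}`. -/
def FreeWord (X : Type u) (x₀ : X) : Type u := {l : List X // x₀ ∉ l}

/-- Concatenation of words. -/
def FreeWord.concat {X : Type u} {x₀ : X} (x y : FreeWord X x₀) : FreeWord X x₀ :=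
  ⟨x.1 ++ y.1, fun h => (List.mem_append.mp h).elim x.2 y.2⟩

/-- The order (length) of a word. -/
def FreeWord.ord {X : Type u} {x₀ : X} (x : FreeWord X x₀) : ℕ := x.1.length

/-- The empty word `ε`. -/
def FreeWord.epsilon (X : Type u) (x₀ : X) : FreeWord X x₀ := ⟨[], by simp⟩

/-- The one-letter word on a letter `u ≠ x₀`. -/
def FreeWord.single {X : Type u} {x₀ : X} (u : X) (h : u ≠ x₀) : FreeWord X x₀ :=
  ⟨[u], by simp only [List.mem_singleton]; exact fun hh => h hh.symm⟩

/-- `‖x₁⋯x_k‖_E = Σᵢ D_E(x₀, xᵢ)`. -/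
noncomputable def wnormL {X : Type u} (E : Set (X × X)) (x₀ : X) (l : List X) : ℕ∞ :=
  (l.map fun a => DE E x₀ a).sum

/-- `‖x₁⋯x_k‖^E = Σᵢ D_E(xᵢ, x₀)`. -/
noncomputable def wnormR {X : Type u} (E : Set (X × X)) (x₀ : X) (l : List X) : ℕ∞ :=
  (l.map fun a => DE E a x₀).sum

open Classical in
/-- `D*_E` on underlying lists: equal words are at distance `0`; otherwise strip the longest
common prefix `a`, at the first difference `x = a·b·c`, `x' = a·b'·c'` (with `b = x₀` and `c = ε`
when a word has run out) the value is `D_E(b,b') + ‖c‖_E + ‖c'‖^E`. -/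
noncomputable def DstarList {X : Type u} (E : Set (X × X)) (x₀ : X) :
    List X → List X → ℕ∞
  | [], [] => 0
  | [], b :: t => DE E x₀ b + wnormR E x₀ t
  | a :: s, [] => DE E a x₀ + wnormL E x₀ s
  | a :: s, b :: t =>
      if a = b then DstarList E x₀ s t
      else DE E a b + wnormL E x₀ s + wnormR E x₀ t

/-- `D*_E` on the free product `∗X`. -/
noncomputable def Dstar {X : Type u} (E : Set (X × X)) (x₀ : X)
    (x y : FreeWord X x₀) : ℕ∞ :=
  DstarList E x₀ x.1 y.1

/-- `⟨E,n⟩ = {(x,x') : D*_E(x,x') ≤ n}`. -/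
def bracket {X : Type u} (E : Set (X × X)) (x₀ : X) (n : ℕ) :
    Set (FreeWord X x₀ × FreeWord X x₀) :=
  {p | Dstar E x₀ p.1 p.2 ≤ (n : ℕ∞)}

/-- The coarse free product structure `∗𝓔`: the subset closure of the sets `⟨E,n⟩`. -/
def freeEnts {X : Type u} (𝓔 : Set (Set (X × X))) (x₀ : X) :
    Set (Set (FreeWord X x₀ × FreeWord X x₀)) :=
  {L | ∃ E ∈ 𝓔, ∃ n : ℕ, L ⊆ bracket E x₀ n}

/-- A family of subsets is `E`-disjoint if products of distinct members miss `E`. -/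
def EDisjointFam {Y : Type v} (𝒰 : Set (Set Y)) (E : Set (Y × Y)) : Prop :=
  ∀ U ∈ 𝒰, ∀ V ∈ 𝒰, U ≠ V → ∀ u ∈ U, ∀ v ∈ V, (u, v) ∉ E

/-- A family of subsets is `K`-bounded if `∪ U × U ⊆ K`. -/
def KBoundedFam {Y : Type v} (𝒰 : Set (Set Y)) (K : Set (Y × Y)) : Prop :=
  ∀ U ∈ 𝒰, ∀ u ∈ U, ∀ v ∈ U, (u, v) ∈ K

/-- Asymptotic dimension at most `n` of a space with entourage collection `ents`. -/
def AsdimLE {Y : Type v} (ents : Set (Set (Y × Y))) (n : ℕ) : Prop :=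
  ∀ E ∈ ents, ∃ K ∈ ents, ∃ 𝒰 : Fin (n + 1) → Set (Set Y),
    (∀ y : Y, ∃ i, ∃ V ∈ 𝒰 i, y ∈ V) ∧
    (∀ i, EDisjointFam (𝒰 i) E) ∧
    (∀ i, KBoundedFam (𝒰 i) K)

/-- The subspace coarse structure on `A ⊆ Y`. -/
def subEnts {Y : Type v} (ents : Set (Set (Y × Y))) (A : Set Y) :
    Set (Set (↥A × ↥A)) :=
  {L | (Prod.map ((↑) : A → Y) ((↑) : A → Y)) '' L ∈ ents}

/-- Entourages of the total space `T({U_i}; J) = ⊔ᵢ Uᵢ` of a family of subsets. -/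
def totalEnts {Y : Type v} {J : Type*} (ents : Set (Set (Y × Y))) (U : J → Set Y) :
    Set (Set ((Σ i : J, ↥(U i)) × (Σ i : J, ↥(U i)))) :=
  {L | ∃ E ∈ ents, ∀ p ∈ L, p.1.1 = p.2.1 ∧ ((p.1.2 : Y), (p.2.2 : Y)) ∈ E}

/-- A family `{U_i}` has asymptotic dimension at most `m` uniformly if its total space does. -/
def UniformAsdimLE {Y : Type v} {J : Type*} (ents : Set (Set (Y × Y)))
    (U : J → Set Y) (m : ℕ) : Prop :=
  AsdimLE (totalEnts ents U) m

/-- The symmetric ball `B(x₀, E)`. -/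
def symmBall {X : Type u} (E : Set (X × X)) (x₀ : X) : Set X :=
  {y | (x₀, y) ∈ E ∨ (y, x₀) ∈ E}

/-- The `M`-cone `con_M(A) = A · (∗B(x₀,M))`. -/
def cone {X : Type u} (M : Set (X × X)) (x₀ : X) (A : Set (FreeWord X x₀)) :
    Set (FreeWord X x₀) :=
  {z | ∃ a ∈ A, ∃ w : FreeWord X x₀, (∀ c ∈ w.1, c ∈ symmBall M x₀) ∧ z = a.concat w}

section Coarse

variable {X : Type u} {𝓔 : Set (Set (X × X))}

/-- Every entourage lies in a reflexive symmetric entourage. -/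
theorem IsCoarseStructure.exists_symm (h : IsCoarseStructure 𝓔) {E : Set (X × X)} (hE : E ∈ 𝓔) :
    ∃ F ∈ 𝓔, E ⊆ F ∧ (∀ x, (x, x) ∈ F) ∧ ∀ x y, (x, y) ∈ F → (y, x) ∈ F := by
  obtain ⟨hΔ, hinv, hun, -, -⟩ := h
  refine ⟨(E ∪ Prod.swap '' E) ∪ {p | p.1 = p.2}, hun _ (hun _ hE _ (hinv _ hE)) _ hΔ,
    fun p hp => Or.inl (Or.inl hp), fun x => Or.inr rfl, ?_⟩
  rintro x y ((h | ⟨⟨a, b⟩, hp, h⟩) | h)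
  · exact Or.inl (Or.inr ⟨(x, y), h, rfl⟩)
  · obtain ⟨rfl, rfl⟩ := Prod.mk.inj h
    exact Or.inl (Or.inl hp)
  · exact Or.inr h.symm

theorem IsCoarseStructure.compIter_mem (h : IsCoarseStructure 𝓔) {E : Set (X × X)} (hE : E ∈ 𝓔) :
    ∀ k, compIter E k ∈ 𝓔
  | 0 => h.2.2.2.1 _ hE _ inter_subset_left
  | 1 => hE
  | k + 2 => h.2.2.2.2 _ hE _ (h.compIter_mem hE (k + 1))

theorem IsCoarseStructure.exists_compIter_subset (h : IsCoarseStructure 𝓔) {E : Set (X × X)}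
    (hE : E ∈ 𝓔) (n : ℕ) : ∃ F ∈ 𝓔, ∀ k ≤ n, compIter E k ⊆ F := by
  induction n with
  | zero => exact ⟨_, h.compIter_mem hE 0, fun k hk => by rw [Nat.le_zero.mp hk]⟩
  | succ n ih =>
    obtain ⟨F, hF, hsub⟩ := ih
    refine ⟨F ∪ compIter E (n + 1), h.2.2.1 _ hF _ (h.compIter_mem hE _), fun k hk => ?_⟩
    rcases Nat.le_succ_iff.mp hk with hk | rfl
    · exact (hsub k hk).trans subset_union_left
    · exact subset_union_right

theorem DE_le_one {E : Set (X × X)} {x y : X} (h : (x, y) ∈ E) : DE E x y ≤ 1 :=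
  sInf_le ⟨1, rfl, h⟩

theorem exists_mem_compIter_of_DE_le {E : Set (X × X)} {x y : X} {n : ℕ} (h : DE E x y ≤ n) :
    ∃ k ≤ n, (x, y) ∈ compIter E k := by
  have hne : {n : ℕ∞ | ∃ k : ℕ, n = (k : ℕ∞) ∧ (x, y) ∈ compIter E k}.Nonempty := by
    by_contra hne
    rw [not_nonempty_iff_eq_empty] at hne
    rw [DE, hne, sInf_empty] at h
    exact absurd h (by simp)
  obtain ⟨k, hk, hmem⟩ := csInf_mem hne
  rw [DE, hk] at h
  exact ⟨k, by exact_mod_cast h, hmem⟩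

theorem one_le_DE {E : Set (X × X)} {x y : X} (h : x ≠ y) : 1 ≤ DE E x y := by
  by_contra hlt
  rw [not_le, Order.lt_one_iff] at hlt
  obtain ⟨k, hk, hmem⟩ := exists_mem_compIter_of_DE_le (n := 0) hlt.le
  rw [Nat.le_zero.mp hk] at hmem
  exact h hmem.2

theorem length_le_and_forall_le_of_sum_map_le {α : Type*} {f : α → ℕ∞} {n : ℕ} {l : List α}
    (h1 : ∀ a ∈ l, 1 ≤ f a) (h : (l.map f).sum ≤ n) : l.length ≤ n ∧ ∀ a ∈ l, f a ≤ n := by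
  refine ⟨?_, fun a ha => (List.single_le_sum (by simp) _ (List.mem_map_of_mem ha)).trans h⟩
  have : (l.length : ℕ∞) ≤ (l.map f).sum := by
    clear h
    induction l with
    | nil => simp
    | cons a t ih =>
      simp only [List.length_cons, List.map_cons, List.sum_cons, Nat.cast_add, Nat.cast_one]
      rw [add_comm]
      exact add_le_add (h1 a (by simp)) (ih fun b hb => h1 b (by simp [hb]))
  exact_mod_cast this.trans h

theorem sum_map_le_length {α : Type*} {f : α → ℕ∞} {l : List α} (h : ∀ a ∈ l, f a ≤ 1) :
    (l.map f).sum ≤ l.length := by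
  simpa using List.sum_le_card_nsmul (l.map f) 1 (by simpa using h)

/-- Words at bounded `D*`-distance differ by short tails whose first letters are close and whose
other letters are close to the basepoint. -/
theorem exists_append_of_DstarList_le {E F : Set (X × X)} {x₀ : X} {n : ℕ}
    (hEF : ∀ k ≤ n, compIter E k ⊆ F) (hrefl : ∀ x, (x, x) ∈ F)
    (hsymm : ∀ x y, (x, y) ∈ F → (y, x) ∈ F) :
    ∀ l l' : List X, x₀ ∉ l → x₀ ∉ l' → DstarList E x₀ l l' ≤ n →
      ∃ a s s', l = a ++ s ∧ l' = a ++ s' ∧ s.length ≤ n + 1 ∧ s'.length ≤ n + 1 ∧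
        (s.headD x₀, s'.headD x₀) ∈ F ∧ (∀ x ∈ s.tail, (x₀, x) ∈ F) ∧
        ∀ x ∈ s'.tail, (x₀, x) ∈ F := by
  have hDE : ∀ x y, DE E x y ≤ n → (x, y) ∈ F := fun x y h =>
    let ⟨k, hk, hmem⟩ := exists_mem_compIter_of_DE_le h
    hEF k hk hmem
  have hL : ∀ t : List X, x₀ ∉ t → wnormL E x₀ t ≤ n →
      t.length ≤ n ∧ ∀ x ∈ t, (x₀, x) ∈ F := fun t ht h => by
    have := length_le_and_forall_le_of_sum_map_le
      (f := fun a => DE E x₀ a) (fun a ha => one_le_DE fun he => ht (he ▸ ha)) h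
    exact ⟨this.1, fun x hx => hDE _ _ (this.2 x hx)⟩
  have hR : ∀ t : List X, x₀ ∉ t → wnormR E x₀ t ≤ n →
      t.length ≤ n ∧ ∀ x ∈ t, (x₀, x) ∈ F := fun t ht h => by
    have := length_le_and_forall_le_of_sum_map_le
      (f := fun a => DE E a x₀) (fun a ha => one_le_DE fun he => ht (he ▸ ha)) h
    exact ⟨this.1, fun x hx => hsymm _ _ (hDE _ _ (this.2 x hx))⟩
  intro l
  induction l with
  | nil =>
    rintro (_ | ⟨b, t⟩) - hl' h
    · exact ⟨[], [], [], by simp [hrefl]⟩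
    · rw [DstarList] at h
      simp only [List.mem_cons, not_or] at hl'
      have := hR t hl'.2 (le_add_self.trans h)
      exact ⟨[], [], b :: t, rfl, rfl, by simp, by simpa using this.1,
        hDE _ _ (le_self_add.trans h), by simp, this.2⟩
  | cons a s ih =>
    rintro (_ | ⟨b, t⟩) hl hl' h
    · rw [DstarList] at h
      simp only [List.mem_cons, not_or] at hl
      have := hL s hl.2 (le_add_self.trans h)
      exact ⟨[], a :: s, [], rfl, rfl, by simpa using this.1, by simp,
        hDE _ _ (le_self_add.trans h), this.2, by simp⟩
    · simp only [List.mem_cons, not_or] at hl hl'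
      rw [DstarList] at h
      split_ifs at h with hab
      · subst hab
        obtain ⟨p, q, q', rfl, rfl, hrest⟩ := ih t hl.2 hl'.2 h
        exact ⟨a :: p, q, q', rfl, rfl, hrest⟩
      · have h1 := hL s hl.2 ((le_add_self.trans le_self_add).trans h)
        have h2 := hR t hl'.2 (le_add_self.trans h)
        exact ⟨[], a :: s, b :: t, rfl, rfl, by simpa using h1.1, by simpa using h2.1,
          hDE _ _ ((le_self_add.trans le_self_add).trans h), h1.2, h2.2⟩

theorem DstarList_append (E : Set (X × X)) (x₀ : X) (a s t : List X) :
    DstarList E x₀ (a ++ s) (a ++ t) = DstarList E x₀ s t := by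
  induction a with
  | nil => rfl
  | cons b a ih => simp [DstarList, ih]

theorem wnormL_le_length {G : Set (X × X)} {x₀ : X} {s : List X} (h : ∀ x ∈ s, (x₀, x) ∈ G) :
    wnormL G x₀ s ≤ s.length :=
  sum_map_le_length fun a ha => DE_le_one (h a ha)

theorem wnormR_le_length {G : Set (X × X)} {x₀ : X} {s : List X} (h : ∀ x ∈ s, (x, x₀) ∈ G) :
    wnormR G x₀ s ≤ s.length :=
  sum_map_le_length fun a ha => DE_le_one (h a ha)

theorem DstarList_le_of_forall_mem {G : Set (X × X)} {x₀ : X} {S : Set X}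
    (hS : ∀ x ∈ S, (x₀, x) ∈ G ∧ (x, x₀) ∈ G) (hSS : ∀ x ∈ S, ∀ y ∈ S, (x, y) ∈ G) :
    ∀ s t : List X, (∀ x ∈ s, x ∈ S) → (∀ x ∈ t, x ∈ S) →
      DstarList G x₀ s t ≤ ((s.length + t.length : ℕ) : ℕ∞)
  | [], [], _, _ => by simp [DstarList]
  | [], b :: t, _, ht => by
    simp only [List.mem_cons, forall_eq_or_imp] at ht
    have := add_le_add (DE_le_one (hS b ht.1).1) (wnormR_le_length fun x hx => (hS x (ht.2 x hx)).2)
    rw [DstarList]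
    refine this.trans ?_
    norm_cast
    simp only [List.length_cons, List.length_nil]
    omega
  | a :: s, [], hs, _ => by
    simp only [List.mem_cons, forall_eq_or_imp] at hs
    have := add_le_add (DE_le_one (hS a hs.1).2) (wnormL_le_length fun x hx => (hS x (hs.2 x hx)).1)
    rw [DstarList]
    refine this.trans ?_
    norm_cast
    simp only [List.length_cons, List.length_nil]
    omega
  | a :: s, b :: t, hs, ht => by
    simp only [List.mem_cons, forall_eq_or_imp] at hs ht
    rw [DstarList]
    split_ifs with hab
    · refine (DstarList_le_of_forall_mem hS hSS s t hs.2 ht.2).trans ?_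
      norm_cast
      simp only [List.length_cons]
      omega
    · refine (add_le_add (add_le_add (DE_le_one (hSS a hs.1 b ht.1))
        (wnormL_le_length fun x hx => (hS x (hs.2 x hx)).1))
        (wnormR_le_length fun x hx => (hS x (ht.2 x hx)).2)).trans ?_
      norm_cast
      simp only [List.length_cons]
      omega

theorem DstarList_cons_le_of_forall_mem {G : Set (X × X)} {x₀ : X} {S : Set X}
    (hS : ∀ x ∈ S, (x₀, x) ∈ G ∧ (x, x₀) ∈ G) (hSS : ∀ x ∈ S, ∀ y ∈ S, (x, y) ∈ G)
    {a b : X} (hab : (a, b) ∈ G) {s t : List X} (hs : ∀ x ∈ s, x ∈ S) (ht : ∀ x ∈ t, x ∈ S) :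
    DstarList G x₀ (a :: s) (b :: t) ≤ (((a :: s).length + (b :: t).length : ℕ) : ℕ∞) := by
  rw [DstarList]
  split_ifs with he
  · refine (DstarList_le_of_forall_mem hS hSS s t hs ht).trans ?_
    norm_cast
    simp only [List.length_cons]
    omega
  · refine (add_le_add (add_le_add (DE_le_one hab)
      (wnormL_le_length fun x hx => (hS x (hs x hx)).1))
      (wnormR_le_length fun x hx => (hS x (ht x hx)).2)).trans ?_
    norm_cast
    simp only [List.length_cons]
    omega

end Coarse

section Coloring

variable {Y : Type v} {ents : Set (Set (Y × Y))} {n : ℕ}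

theorem AsdimLE.exists_coloring (h : AsdimLE ents n) {E : Set (Y × Y)} (hE : E ∈ ents) :
    ∃ K ∈ ents, ∃ (c : Y → Fin (n + 1)) (P : Y → Set Y), (∀ y, y ∈ P y) ∧
      (∀ x y, (x, y) ∈ E → c x = c y → P x = P y) ∧
      ∀ x y, y ∈ P x → (x, y) ∈ K := by
  obtain ⟨K, hK, 𝒰, hcov, hdisj, hbdd⟩ := h E hE
  choose c P hP hmem using hcov
  refine ⟨K, hK, c, P, hmem, fun x y hxy hc => ?_, fun x y hy => hbdd _ _ (hP x) _ (hmem x) _ hy⟩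
  by_contra hne
  exact hdisj (c x) _ (hP x) _ (hc ▸ hP y) hne x (hmem x) y (hmem y) hxy

theorem asdimLE_of_exists_coloring
    (h : ∀ E ∈ ents, ∃ K ∈ ents, ∃ (Λ : Type v) (c : Y → Fin (n + 1)) (P : Y → Λ),
      (∀ x y, (x, y) ∈ E → c x = c y → P x = P y) ∧ ∀ x y, P x = P y → (x, y) ∈ K) :
    AsdimLE ents n := by
  intro E hE
  obtain ⟨K, hK, Λ, c, P, hdisj, hbdd⟩ := h E hE
  refine ⟨K, hK, fun i => {V | ∃ l, V = {y | c y = i ∧ P y = l}},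
    fun y => ⟨c y, _, ⟨P y, rfl⟩, rfl, rfl⟩, ?_, ?_⟩
  · rintro i _ ⟨l, rfl⟩ _ ⟨l', rfl⟩ hne x ⟨hcx, hx⟩ y ⟨hcy, hy⟩ hxy
    have := hdisj x y hxy (hcx.trans hcy.symm)
    rw [hx, hy] at this
    exact hne (by rw [this])
  · rintro i _ ⟨l, rfl⟩ x ⟨-, hx⟩ y ⟨-, hy⟩
    exact hbdd x y (hx.trans hy.symm)

end Coloring

section Anchor

variable {X : Type u} {C : Type*}

/-- The piece `P x` is close to the ball around the basepoint. -/
def PieceNear (F : Set (X × X)) (x₀ : X) (P : X → Set X) (x : X) : Prop :=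
  ∃ z ∈ P x, ∃ y, (x₀, y) ∈ F ∧ (y, z) ∈ F

open Classical in
/-- Given the color and the anchor of a word `v`, the color and the anchor of the word `v · x`:
they are kept if `x` is close to the basepoint, or has the current color and lies in a piece close
to the basepoint; otherwise the color is that of `x` and the anchor is the pair `(v, P x)`. -/
noncomputable def anchorStep (F : Set (X × X)) (x₀ : X) (c : X → C) (P : X → Set X)
    (v : List X) (σ : C × Option (List X × Set X)) (x : X) : C × Option (List X × Set X) :=
  if (x₀, x) ∈ F ∨ (c x = σ.1 ∧ PieceNear F x₀ P x) then σ else (c x, some (v, P x))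

/-- The color and the anchor obtained by reading a word letter by letter after the word `v`. -/
noncomputable def anchor (F : Set (X × X)) (x₀ : X) (c : X → C) (P : X → Set X) :
    List X → C × Option (List X × Set X) → List X → C × Option (List X × Set X)
  | _, σ, [] => σ
  | v, σ, x :: t => anchor F x₀ c P (v ++ [x]) (anchorStep F x₀ c P v σ x) t

variable {F : Set (X × X)} {x₀ : X} {c : X → C} {P : X → Set X}

theorem anchor_append (v : List X) (σ : C × Option (List X × Set X)) (s t : List X) :
    anchor F x₀ c P v σ (s ++ t) = anchor F x₀ c P (v ++ s) (anchor F x₀ c P v σ s) t := by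
  induction s generalizing v σ with
  | nil => simp [anchor]
  | cons x s ih => simp [anchor, ih]

theorem anchor_of_forall_mem (v : List X) (σ : C × Option (List X × Set X)) {s : List X}
    (hs : ∀ x ∈ s, (x₀, x) ∈ F) : anchor F x₀ c P v σ s = σ := by
  induction s generalizing v σ with
  | nil => rfl
  | cons x s ih =>
    simp only [List.mem_cons, forall_eq_or_imp] at hs
    rw [anchor, ih _ _ hs.2, anchorStep, if_pos (Or.inl hs.1)]

theorem anchor_eq_anchorStep (hrefl : ∀ x, (x, x) ∈ F) (v : List X)
    (σ : C × Option (List X × Set X)) {s : List X} (hs : ∀ x ∈ s.tail, (x₀, x) ∈ F) :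
    anchor F x₀ c P v σ s = anchorStep F x₀ c P v σ (s.headD x₀) := by
  cases s with
  | nil => simp [anchor, anchorStep, hrefl]
  | cons x s => exact anchor_of_forall_mem _ _ hs

theorem anchorStep_eq_of_fst_eq (hsymm : ∀ x y, (x, y) ∈ F → (y, x) ∈ F) (hP : ∀ x, x ∈ P x)
    (hc : ∀ x y, (x, y) ∈ F → c x = c y → P x = P y) (v : List X)
    (σ : C × Option (List X × Set X)) {x y : X} (hxy : (x, y) ∈ F)
    (h : (anchorStep F x₀ c P v σ x).1 = (anchorStep F x₀ c P v σ y).1) :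
    anchorStep F x₀ c P v σ x = anchorStep F x₀ c P v σ y := by
  have key : ∀ x y, (x, y) ∈ F → ((x₀, x) ∈ F ∨ (c x = σ.1 ∧ PieceNear F x₀ P x)) →
      c y = σ.1 → (x₀, y) ∈ F ∨ (c y = σ.1 ∧ PieceNear F x₀ P y) := by
    rintro x y hxy (hx | ⟨hx, hnear⟩) hy
    · exact Or.inr ⟨hy, y, hP y, x, hx, hxy⟩
    · refine Or.inr ⟨hy, ?_⟩
      rwa [PieceNear, ← hc x y hxy (hx.trans hy.symm)]
  unfold anchorStep at h ⊢
  split_ifs at h ⊢ with hx hy hy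
  · rfl
  · exact absurd (key x y hxy hx h.symm) hy
  · exact absurd (key y x (hsymm _ _ hxy) hy h) hx
  · simp only at h
    rw [h, hc x y hxy h]

theorem anchor_cases (v : List X) (σ : C × Option (List X × Set X)) (s : List X) :
    ((anchor F x₀ c P v σ s).2 = σ.2 ∧ ∀ x ∈ s, (x₀, x) ∈ F ∨ PieceNear F x₀ P x) ∨
      ∃ u y t, s = u ++ y :: t ∧ (anchor F x₀ c P v σ s).2 = some (v ++ u, P y) ∧
        ∀ x ∈ t, (x₀, x) ∈ F ∨ PieceNear F x₀ P x := by
  induction s generalizing v σ with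
  | nil => simp [anchor]
  | cons x s ih =>
    rw [anchor]
    rcases ih (v ++ [x]) (anchorStep F x₀ c P v σ x) with ⟨h, hs⟩ | ⟨u, y, t, rfl, h, ht⟩
    · by_cases hx : (x₀, x) ∈ F ∨ (c x = σ.1 ∧ PieceNear F x₀ P x)
      · refine Or.inl ⟨by rw [h, anchorStep, if_pos hx], ?_⟩
        simp only [List.mem_cons, forall_eq_or_imp]
        exact ⟨hx.imp_right And.right, hs⟩
      · exact Or.inr ⟨[], x, s, rfl, by rw [h, anchorStep, if_neg hx]; simp, hs⟩
    · exact Or.inr ⟨x :: u, y, t, rfl, by rw [h]; simp, ht⟩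

end Anchor

/-- The start of the block of length `N` that precedes the one containing `L`. -/
def blockStart (N L : ℕ) : ℕ := (L / N - 1) * N

theorem blockStart_le {N L j : ℕ} (h : L < j + N) : blockStart N L ≤ j := by
  have := Nat.div_mul_le_self L N
  rw [blockStart, Nat.sub_mul, one_mul]
  omega

theorem lt_blockStart_add {N L : ℕ} (hN : 0 < N) : L < blockStart N L + 2 * N := by
  have h := Nat.lt_div_mul_add hN (a := L)
  rw [blockStart, Nat.sub_mul, one_mul]
  omega

theorem div_eq_div_of_mod_two_eq {N a b : ℕ} (hN : 0 < N) (hab : a < b + N) (hba : b < a + N)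
    (h : a / N % 2 = b / N % 2) : a / N = b / N := by
  have h1 : a / N ≤ b / N + 1 := by
    rw [← Nat.add_div_right b hN]
    exact Nat.div_le_div_right hab.le
  have h2 : b / N ≤ a / N + 1 := by
    rw [← Nat.add_div_right a hN]
    exact Nat.div_le_div_right hba.le
  omega

/-- If `asdim X ≤ k` then the coarse free product satisfies `asdim ∗X ≤ 2k + 1`. -/
theorem asdim_free_product_le
    {X : Type u} (𝓔 : Set (Set (X × X))) (h𝓔 : IsCoarseStructure 𝓔) (x₀ : X)
    (k : ℕ) (hX : AsdimLE 𝓔 k) :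
    AsdimLE (freeEnts 𝓔 x₀) (2 * k + 1) := by
  apply asdimLE_of_exists_coloring
  rintro L ⟨E, hE, n, hL⟩
  obtain ⟨F₀, hF₀, hEF₀⟩ := h𝓔.exists_compIter_subset hE n
  obtain ⟨F, hF, hF₀F, hrefl, hsymm⟩ := h𝓔.exists_symm hF₀
  obtain ⟨K, hK, c, P, hP, hc, hPK⟩ := hX.exists_coloring hF
  obtain ⟨K', hK', hKK', hKrefl, hKsymm⟩ := h𝓔.exists_symm (h𝓔.2.2.1 _ hK _ hF)
  set G₀ := rcomp K' (rcomp K' K')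
  have hG₀mem : G₀ ∈ 𝓔 := h𝓔.2.2.2.2 _ hK' _ (h𝓔.2.2.2.2 _ hK' _ hK')
  have hG₀symm : ∀ x y, (x, y) ∈ G₀ → (y, x) ∈ G₀ := by
    rintro x y ⟨a, hxa, b, hab, hby⟩
    exact ⟨b, hKsymm _ _ hby, a, hKsymm _ _ hab, hKsymm _ _ hxa⟩
  have hK'G₀ : K' ⊆ G₀ := fun p hp => ⟨p.1, hKrefl _, p.1, hKrefl _, hp⟩
  have hG₀refl : ∀ x, (x, x) ∈ G₀ := fun x => hK'G₀ (hKrefl x)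
  set G := rcomp G₀ G₀
  have hG₀G : G₀ ⊆ G := fun p hp => ⟨p.1, hG₀refl _, hp⟩
  set N := n + 2 with hN
  have hN0 : 0 < N := by omega
  let q : List X → Fin (k + 1) × Option (List X × Set X) := fun w =>
    anchor F x₀ c P [] (0, none) (w.drop (blockStart N w.length))
  let e : Fin 2 × Fin (k + 1) ≃ Fin (2 * k + 1 + 1) :=
    finProdFinEquiv.trans (finCongr (by ring))
  refine ⟨bracket G x₀ (4 * N), ⟨G, h𝓔.2.2.2.2 _ hG₀mem _ hG₀mem, 4 * N, Subset.rfl⟩,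
    ℕ × List X × Fin (k + 1) × Option (List X × Set X),
    fun w => e (⟨w.1.length / N % 2, Nat.mod_lt _ two_pos⟩, (q w.1).1),
    fun w => (w.1.length / N, w.1.take (blockStart N w.1.length), q w.1), ?_, ?_⟩
  · rintro ⟨l, hl⟩ ⟨l', hl'⟩ hmem hcol
    obtain ⟨a, s, s', rfl, rfl, hs, hs', hhead, htail, htail'⟩ :=
      exists_append_of_DstarList_le (fun k hk => (hEF₀ k hk).trans hF₀F) hrefl hsymm l l' hl hl'
        (hL hmem)
    obtain ⟨hpar, hqc⟩ := Prod.mk.inj (e.injective hcol)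
    have hdiv : (a ++ s).length / N = (a ++ s').length / N :=
      div_eq_div_of_mod_two_eq hN0 (by simp only [List.length_append]; omega)
        (by simp only [List.length_append]; omega) (Fin.mk.inj hpar)
    have hstart : blockStart N (a ++ s').length = blockStart N (a ++ s).length := by
      rw [blockStart, blockStart, hdiv]
    have hle : blockStart N (a ++ s).length ≤ a.length :=
      blockStart_le (by simp only [List.length_append]; omega)
    simp only [q, hstart, List.drop_append_of_le_length hle, anchor_append,
      anchor_eq_anchorStep hrefl _ _ htail, anchor_eq_anchorStep hrefl _ _ htail'] at hqc
    simp only [q, hdiv, hstart, List.drop_append_of_le_length hle, anchor_append,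
      List.take_append_of_le_length hle,
      anchor_eq_anchorStep hrefl _ _ htail, anchor_eq_anchorStep hrefl _ _ htail']
    rw [anchorStep_eq_of_fst_eq hsymm hP hc _ _ hhead hqc]
  · rintro ⟨l, hl⟩ ⟨l', hl'⟩ hlab
    obtain ⟨hdiv, htake, hq⟩ : l.length / N = l'.length / N ∧
        l.take (blockStart N l.length) = l'.take (blockStart N l'.length) ∧ q l = q l' := by
      simpa using hlab
    set S : Set X := {x | (x₀, x) ∈ F ∨ PieceNear F x₀ P x}
    have hS₀ : ∀ x ∈ S, (x₀, x) ∈ G₀ := by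
      rintro x (hx | ⟨z, hz, y, hy, hyz⟩)
      · exact hK'G₀ (hKK' (Or.inr hx))
      · exact ⟨y, hKK' (Or.inr hy), z, hKK' (Or.inr hyz),
          hKsymm _ _ (hKK' (Or.inl (hPK x z hz)))⟩
    have hS : ∀ x ∈ S, (x₀, x) ∈ G ∧ (x, x₀) ∈ G := fun x hx =>
      ⟨hG₀G (hS₀ x hx), hG₀G (hG₀symm _ _ (hS₀ x hx))⟩
    have hSS : ∀ x ∈ S, ∀ y ∈ S, (x, y) ∈ G := fun x hx y hy =>
      ⟨x₀, hG₀symm _ _ (hS₀ x hx), hS₀ y hy⟩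
    have hlen : ∀ w : List X, (w.drop (blockStart N w.length)).length ≤ 2 * N := fun w => by
      have := lt_blockStart_add (L := w.length) hN0
      rw [List.length_drop]
      omega
    have hd := hlen l
    have hd' := hlen l'
    change DstarList G x₀ l l' ≤ ((4 * N : ℕ) : ℕ∞)
    rw [← List.take_append_drop (blockStart N l.length) l,
      ← List.take_append_drop (blockStart N l'.length) l', htake, DstarList_append]
    have hq2 := congrArg Prod.snd hq
    simp only [q] at hq2
    generalize l.drop (blockStart N l.length) = r at hq2 hd ⊢
    generalize l'.drop (blockStart N l'.length) = r' at hq2 hd' ⊢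
    rcases anchor_cases (F := F) (x₀ := x₀) (c := c) (P := P) [] (0, none) r with
      ⟨h1, hr⟩ | ⟨u, y, t, rfl, h1, ht⟩ <;>
    rcases anchor_cases (F := F) (x₀ := x₀) (c := c) (P := P) [] (0, none) r' with
      ⟨h2, hr'⟩ | ⟨u', y', t', rfl, h2, ht'⟩ <;>
    rw [h1, h2] at hq2
    · refine (DstarList_le_of_forall_mem hS hSS r r' hr hr').trans ?_
      exact_mod_cast (by omega)
    · simp at hq2
    · simp at hq2
    · simp only [List.nil_append, Option.some.injEq, Prod.mk.injEq] at hq2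
      obtain ⟨rfl, hPP⟩ := hq2
      rw [DstarList_append]
      have hyy : (y, y') ∈ G := hG₀G (hK'G₀ (hKK' (Or.inl (hPK y y' (hPP ▸ hP y')))))
      refine (DstarList_cons_le_of_forall_mem hS hSS hyy ht ht').trans ?_
      simp only [List.length_append] at hd hd'
      exact_mod_cast (by omega)
end

section
/- Let f : X → Y be a uniformly expansive map of coarse spaces (X,𝓔) and (Y,𝓕). If asdim Y ≤ k and the coarse fibers of f have asymptotic dimension at most n uniformly, then asdim X ≤ (n+1)(k+1) − 1. -/
open Set

universe u v

/-- Fibering estimate for asymptotic dimension: if `f : X → Y` is uniformly expansive,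
`asdim Y ≤ k` and the coarse fibers of `f` have asymptotic dimension at most `n` uniformly,
then `asdim X ≤ (n+1)(k+1) − 1`. -/
theorem asdim_fibering
    {X : Type u} {Y : Type v}
    (𝓔 : Set (Set (X × X))) (𝓕 : Set (Set (Y × Y)))
    (h𝓔 : IsCoarseStructure 𝓔) (h𝓕 : IsCoarseStructure 𝓕)
    (f : X → Y) (hf : ∀ E ∈ 𝓔, (Prod.map f f) '' E ∈ 𝓕)
    (k n : ℕ) (hY : AsdimLE 𝓕 k)
    (hfib : ∀ L ∈ 𝓔, ∀ F ∈ 𝓕, ∃ K ∈ 𝓔,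
      ∀ A : Set X, (∃ y : Y, ∀ a ∈ A, (y, f a) ∈ F) →
        ∃ 𝒰 : Fin (n + 1) → Set (Set X),
          (∀ a ∈ A, ∃ i, ∃ U ∈ 𝒰 i, a ∈ U) ∧
          (∀ i, ∀ U ∈ 𝒰 i, U ⊆ A) ∧
          (∀ i, EDisjointFam (𝒰 i) L) ∧
          (∀ i, KBoundedFam (𝒰 i) K)) :
    AsdimLE 𝓔 ((n + 1) * (k + 1) - 1) := by
  intro E hE
  obtain ⟨KY, hKY, 𝒱, hcov, hdisj, hbdd⟩ := hY _ (hf E hE)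
  obtain ⟨K, hK, hfiber⟩ := hfib E hE KY hKY
  have hpre : ∀ p : {p : Fin (k + 1) × Set Y // p.2 ∈ 𝒱 p.1 ∧ p.2.Nonempty},
      ∃ y : Y, ∀ a ∈ f ⁻¹' p.1.2, (y, f a) ∈ KY := by
    rintro ⟨⟨j, V⟩, hV, y, hy⟩
    exact ⟨y, fun a ha => hbdd j V hV y hy (f a) ha⟩
  choose 𝒰 hUcov hUsub hUdisj hUbdd using fun p => hfiber _ (hpre p)
  have hcard : (n + 1) * (k + 1) - 1 + 1 = (n + 1) * (k + 1) :=
    Nat.sub_add_cancel (Nat.mul_pos n.succ_pos k.succ_pos)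
  let e : Fin ((n + 1) * (k + 1) - 1 + 1) ≃ Fin (n + 1) × Fin (k + 1) :=
    (finCongr hcard).trans finProdFinEquiv.symm
  refine ⟨K, hK, fun m => {U | ∃ V, ∃ h : V ∈ 𝒱 (e m).2 ∧ V.Nonempty,
    U ∈ 𝒰 ⟨((e m).2, V), h⟩ (e m).1}, ?_, ?_, ?_⟩
  · intro x
    obtain ⟨j, V, hV, hx⟩ := hcov (f x)
    obtain ⟨i, U, hU, hxU⟩ := hUcov ⟨(j, V), hV, f x, hx⟩ x hx
    refine ⟨e.symm (i, j), U, ?_, hxU⟩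
    simp only [mem_ofPred_eq, Equiv.apply_symm_apply]
    exact ⟨V, ⟨hV, f x, hx⟩, hU⟩
  · rintro m U ⟨V, hV, hU⟩ U' ⟨V', hV', hU'⟩ hne u hu u' hu' huu'
    by_cases hVV : V = V'
    · subst hVV
      exact hUdisj _ _ U hU U' hU' hne u hu u' hu' huu'
    · exact hdisj _ V hV.1 V' hV'.1 hVV (f u) (hUsub _ _ U hU hu) (f u')
        (hUsub _ _ U' hU' hu') ⟨(u, u'), huu', rfl⟩
  · rintro m U ⟨V, hV, hU⟩
    exact hUbdd _ _ U hU
end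

section
/- Let (X,𝓔) be a coarse space. Assume there is k ≥ 1 such that for every infinite sequence E₁ ⊆ E₂ ⊆ ⋯ of entourages there is a finite sequence 𝒰₁, 𝒰₂, …, 𝒰ₙ of families of subsets of X such that ∪ᵢ𝒰ᵢ covers X, each 𝒰ᵢ is Eᵢ-disjoint, and each 𝒰ᵢ has asymptotic dimension bounded by k−1 uniformly. Then X has coarse property C. -/
open Set

universe u v

/-- Coarse property C: for every increasing sequence of entourages `E₁ ⊆ E₂ ⊆ ⋯` there are
finitely many families `𝒰₁, …, 𝒰ₙ` of subsets whose union covers the space, with `𝒰ᵢ`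
being `Eᵢ`-disjoint and bounded. -/
def HasCoarsePropC {Y : Type v} (ents : Set (Set (Y × Y))) : Prop :=
  ∀ E : ℕ → Set (Y × Y), (∀ i, E i ∈ ents) → (∀ i, E i ⊆ E (i + 1)) →
    ∃ n : ℕ, ∃ 𝒰 : Fin n → Set (Set Y),
      (∀ y : Y, ∃ i, ∃ U ∈ 𝒰 i, y ∈ U) ∧
      (∀ i : Fin n, EDisjointFam (𝒰 i) (E i)) ∧
      (∀ i : Fin n, ∃ K ∈ ents, KBoundedFam (𝒰 i) K)

/-- The family of subsets of `Y` underlying a family of subsets of a total space. -/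
def projFam {Y : Type v} {J : Type*} {U : J → Set Y} (𝒱 : Set (Set (Σ i : J, ↥(U i)))) :
    Set (Set Y) :=
  (fun V => (fun p => (p.2 : Y)) '' V) '' 𝒱

lemma eDisjointFam_projFam {Y : Type v} {𝒰 : Set (Set Y)} {F : Set (Y × Y)}
    (h𝒰 : EDisjointFam 𝒰 F) {𝒱 : Set (Set (Σ U : ↥𝒰, ↥(U : Set Y)))}
    (h𝒱 : EDisjointFam 𝒱 {p | p.1.1 = p.2.1 ∧ ((p.1.2 : Y), (p.2.2 : Y)) ∈ F}) :
    EDisjointFam (projFam 𝒱) F := by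
  rintro _ ⟨V, hV, rfl⟩ _ ⟨V', hV', rfl⟩ hne _ ⟨⟨U, u⟩, hu, rfl⟩ _ ⟨⟨U', u'⟩, hu', rfl⟩ hF
  by_cases hU : U = U'
  · exact h𝒱 V hV V' hV' (fun hVV => hne (by rw [hVV])) _ hu _ hu' ⟨hU, hF⟩
  · exact h𝒰 U U.2 U' U'.2 (fun hUU => hU (Subtype.ext hUU)) _ u.2 _ u'.2 hF

lemma exists_kBoundedFam_projFam {Y : Type v} {J : Type*} {ents : Set (Set (Y × Y))}
    {U : J → Set Y} {K : Set ((Σ i : J, ↥(U i)) × (Σ i : J, ↥(U i)))}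
    (hK : K ∈ totalEnts ents U) :
    ∃ E ∈ ents, ∀ 𝒱, KBoundedFam 𝒱 K → KBoundedFam (projFam 𝒱) E := by
  obtain ⟨E, hE, hKE⟩ := hK
  refine ⟨E, hE, fun 𝒱 h𝒱 => ?_⟩
  rintro _ ⟨V, hV, rfl⟩ _ ⟨p, hp, rfl⟩ _ ⟨q, hq, rfl⟩
  exact (hKE _ (h𝒱 V hV p hp q hq)).2

lemma EDisjointFam.mono {Y : Type v} {𝒰 : Set (Set Y)} {E F : Set (Y × Y)}
    (h : EDisjointFam 𝒰 F) (hEF : E ⊆ F) : EDisjointFam 𝒰 E :=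
  fun U hU V hV hne u hu v hv hE => h U hU V hV hne u hu v hv (hEF hE)

/-- An `F`-disjoint family of uniform asymptotic dimension at most `m` refines to `m + 1`
bounded `F`-disjoint families with the same union. -/
lemma UniformAsdimLE.exists_refinement {Y : Type v} {ents : Set (Set (Y × Y))}
    {𝒰 : Set (Set Y)} {m : ℕ} (h : UniformAsdimLE ents (fun U : ↥𝒰 => (U : Set Y)) m)
    {F : Set (Y × Y)} (hF : F ∈ ents) (h𝒰 : EDisjointFam 𝒰 F) :
    ∃ 𝒲 : Fin (m + 1) → Set (Set Y),
      (∀ U ∈ 𝒰, ∀ y ∈ U, ∃ j, ∃ W ∈ 𝒲 j, y ∈ W) ∧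
      (∀ j, EDisjointFam (𝒲 j) F) ∧
      (∀ j, ∃ K ∈ ents, KBoundedFam (𝒲 j) K) := by
  obtain ⟨K, hK, 𝒱, hcov, hdisj, hbdd⟩ :=
    h {p | p.1.1 = p.2.1 ∧ ((p.1.2 : Y), (p.2.2 : Y)) ∈ F} ⟨F, hF, fun p hp => hp⟩
  obtain ⟨E, hE, hproj⟩ := exists_kBoundedFam_projFam hK
  refine ⟨fun j => projFam (𝒱 j), fun U hU y hy => ?_,
    fun j => eDisjointFam_projFam h𝒰 (hdisj j), fun j => ⟨E, hE, hproj _ (hbdd j)⟩⟩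
  obtain ⟨j, V, hV, hyV⟩ := hcov ⟨⟨U, hU⟩, ⟨y, hy⟩⟩
  exact ⟨j, _, ⟨V, hV, rfl⟩, _, hyV, rfl⟩

/-- If there is `k ≥ 1` such that for every increasing sequence of entourages there are
finitely many families covering `X`, the `i`-th being `Eᵢ`-disjoint and of asymptotic
dimension at most `k − 1` uniformly, then `X` has coarse property C. -/
theorem coarse_property_C_of_uniform_asdim_families
    {X : Type u} (𝓔 : Set (Set (X × X))) (h𝓔 : IsCoarseStructure 𝓔)
    (k : ℕ) (hk : 1 ≤ k)
    (h : ∀ E : ℕ → Set (X × X), (∀ i, E i ∈ 𝓔) → (∀ i, E i ⊆ E (i + 1)) →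
      ∃ n : ℕ, ∃ 𝒰 : Fin n → Set (Set X),
        (∀ x : X, ∃ i, ∃ U ∈ 𝒰 i, x ∈ U) ∧
        (∀ i : Fin n, EDisjointFam (𝒰 i) (E i)) ∧
        (∀ i : Fin n, UniformAsdimLE 𝓔 (fun U : ↥(𝒰 i) => (U : Set X)) (k - 1))) :
    HasCoarsePropC 𝓔 := by
  obtain ⟨m, rfl⟩ : ∃ m, k = m + 1 := ⟨k - 1, by omega⟩
  intro E hE hmono
  have hE_mono : Monotone E := monotone_nat_of_le_succ hmono
  obtain ⟨n, 𝒰, hcov, hdisj, hasdim⟩ := h (fun i => E ((m + 1) * i + m)) (fun i => hE _)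
    (fun i => hE_mono (by gcongr; omega))
  choose 𝒲 h𝒲cov h𝒲disj h𝒲bdd using fun i : Fin n =>
    UniformAsdimLE.exists_refinement (hasdim i) (hE _) (hdisj i)
  refine ⟨n * (m + 1), fun i => 𝒲 i.divNat i.modNat, fun x => ?_, fun i => ?_,
    fun i => h𝒲bdd _ _⟩
  · obtain ⟨i, U, hU, hx⟩ := hcov x
    obtain ⟨j, W, hW, hxW⟩ := h𝒲cov i U hU x hx
    obtain ⟨l, hl⟩ := finProdFinEquiv.symm.surjective (i, j)
    obtain ⟨rfl, rfl⟩ : l.divNat = i ∧ l.modNat = j := Prod.mk.inj hl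
    exact ⟨l, W, hW, hxW⟩
  · refine (h𝒲disj _ _).mono (hE_mono ?_)
    calc (i : ℕ) = (m + 1) * (i / (m + 1)) + i % (m + 1) := (Nat.div_add_mod _ _).symm
      _ ≤ (m + 1) * i.divNat + m := by
        rw [Fin.coe_divNat]
        gcongr
        exact Nat.le_of_lt_succ (Nat.mod_lt _ m.succ_pos)
end

section
/- Let (B,𝓔) be a coarse space with basepoint x₀ such that B × B ∈ 𝓔. Then the coarse free product satisfies asdim(∗B, ∗𝓔) ≤ 1. -/
open Set

universe u v

theorem one_le_DE_of_ne {X : Type u} (E : Set (X × X)) {x y : X} (h : x ≠ y) :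
    1 ≤ DE E x y := by
  refine le_sInf ?_
  rintro _ ⟨k, rfl, hk⟩
  cases k with
  | zero => exact absurd hk.2 h
  | succ k => exact_mod_cast Nat.succ_le_succ (Nat.zero_le k)

theorem DE_univ_le_one {X : Type u} (x y : X) : DE univ x y ≤ 1 :=
  sInf_le ⟨1, rfl, mem_univ _⟩

theorem length_le_wnormL {X : Type u} (E : Set (X × X)) {x₀ : X} {l : List X} (h : x₀ ∉ l) :
    (l.length : ℕ∞) ≤ wnormL E x₀ l := by
  induction l with
  | nil => simp
  | cons a l ih =>
    rw [List.mem_cons, not_or] at h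
    simpa [wnormL, add_comm] using add_le_add (one_le_DE_of_ne E h.1) (ih h.2)

theorem length_le_wnormR {X : Type u} (E : Set (X × X)) {x₀ : X} {l : List X} (h : x₀ ∉ l) :
    (l.length : ℕ∞) ≤ wnormR E x₀ l := by
  induction l with
  | nil => simp
  | cons a l ih =>
    rw [List.mem_cons, not_or] at h
    simpa [wnormR, add_comm] using add_le_add (one_le_DE_of_ne E (Ne.symm h.1)) (ih h.2)

theorem wnormL_univ_le_length {X : Type u} (x₀ : X) (l : List X) :
    wnormL univ x₀ l ≤ l.length := by
  induction l with
  | nil => simp [wnormL]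
  | cons a l ih => simpa [wnormL, add_comm] using add_le_add (DE_univ_le_one x₀ a) ih

theorem wnormR_univ_le_length {X : Type u} (x₀ : X) (l : List X) :
    wnormR univ x₀ l ≤ l.length := by
  induction l with
  | nil => simp [wnormR]
  | cons a l ih => simpa [wnormR, add_comm] using add_le_add (DE_univ_le_one a x₀) ih

/-- Words at distance at most `n` differ only by tails of length at most `n`. -/
theorem exists_prefix_of_DstarList_le {X : Type u} (E : Set (X × X)) {x₀ : X} {n : ℕ} :
    ∀ {l l' : List X}, x₀ ∉ l → x₀ ∉ l' → DstarList E x₀ l l' ≤ n →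
      ∃ p s t, l = p ++ s ∧ l' = p ++ t ∧ s.length ≤ n ∧ t.length ≤ n
  | [], [], _, _, _ => ⟨[], [], [], rfl, rfl, by simp, by simp⟩
  | [], b :: t, _, h', h => by
    rw [List.mem_cons, not_or] at h'
    have := (add_le_add (one_le_DE_of_ne E h'.1) (length_le_wnormR E h'.2)).trans h
    refine ⟨[], [], b :: t, rfl, rfl, by simp, ?_⟩
    have : 1 + t.length ≤ n := by exact_mod_cast this
    simpa [add_comm] using this
  | a :: s, [], hl, _, h => by
    rw [List.mem_cons, not_or] at hl
    have := (add_le_add (one_le_DE_of_ne E (Ne.symm hl.1)) (length_le_wnormL E hl.2)).trans h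
    refine ⟨[], a :: s, [], rfl, rfl, ?_, by simp⟩
    have : 1 + s.length ≤ n := by exact_mod_cast this
    simpa [add_comm] using this
  | a :: s, b :: t, hl, h', h => by
    rw [List.mem_cons, not_or] at hl h'
    rw [DstarList] at h
    split_ifs at h with hab
    · obtain ⟨p, s', t', rfl, rfl, hs, ht⟩ := exists_prefix_of_DstarList_le E hl.2 h'.2 h
      exact ⟨a :: p, s', t', rfl, by rw [hab]; rfl, hs, ht⟩
    · have := (add_le_add (add_le_add (one_le_DE_of_ne E hab) (length_le_wnormL E hl.2))
        (length_le_wnormR E h'.2)).trans h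
      have : 1 + s.length + t.length ≤ n := by exact_mod_cast this
      exact ⟨[], a :: s, b :: t, rfl, rfl, by simp; omega, by simp; omega⟩

theorem DstarList_univ_le {X : Type u} (x₀ : X) :
    ∀ l l' : List X, DstarList univ x₀ l l' ≤ ((l.length + l'.length : ℕ) : ℕ∞)
  | [], [] => by simp [DstarList]
  | [], b :: t => by
    simpa [DstarList, add_comm] using add_le_add (DE_univ_le_one x₀ b) (wnormR_univ_le_length x₀ t)
  | a :: s, [] => by
    simpa [DstarList, add_comm] using add_le_add (DE_univ_le_one a x₀) (wnormL_univ_le_length x₀ s)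
  | a :: s, b :: t => by
    rw [DstarList]
    split_ifs with hab
    · refine (DstarList_univ_le x₀ s t).trans ?_
      norm_cast
      simp only [List.length_cons]
      omega
    · refine (add_le_add (add_le_add (DE_univ_le_one a b) (wnormL_univ_le_length x₀ s))
        (wnormR_univ_le_length x₀ t)).trans ?_
      norm_cast
      simp only [List.length_cons]
      omega

theorem DstarList_append_left {X : Type u} (E : Set (X × X)) (x₀ : X) (p s t : List X) :
    DstarList E x₀ (p ++ s) (p ++ t) = DstarList E x₀ s t := by
  induction p with
  | nil => rfl
  | cons a p ih => simpa [DstarList] using ih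

/-- The words whose length lies in `[k * r, (k + 1) * r)` and whose prefix of length
`(k - 1) * r` is `p`. -/
def annulusPiece {X : Type u} (x₀ : X) (r k : ℕ) (p : List X) : Set (FreeWord X x₀) :=
  {y | y.1.length / r = k ∧ y.1.take ((k - 1) * r) = p}

theorem Dstar_univ_le_of_mem_annulusPiece {X : Type u} {x₀ : X} {r k : ℕ} (hr : 0 < r)
    {p : List X} {x y : FreeWord X x₀} (hx : x ∈ annulusPiece x₀ r k p)
    (hy : y ∈ annulusPiece x₀ r k p) : Dstar univ x₀ x y ≤ ((4 * r : ℕ) : ℕ∞) := by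
  have hlen : ∀ z ∈ annulusPiece x₀ r k p, (z.1.drop ((k - 1) * r)).length ≤ 2 * r := by
    rintro z ⟨hz, -⟩
    have h := Nat.lt_mul_of_div_lt (hz.trans_lt k.lt_succ_self) hr
    rw [List.length_drop]
    cases k with
    | zero => simp at h ⊢; omega
    | succ k =>
      simp only [Nat.succ_eq_add_one, add_tsub_cancel_right] at h ⊢
      have : (k + 1 + 1) * r = k * r + 2 * r := by ring
      rw [mul_comm] at h
      grind
  rw [Dstar, ← List.take_append_drop ((k - 1) * r) x.1, ← List.take_append_drop ((k - 1) * r) y.1,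
    hx.2, hy.2, DstarList_append_left]
  refine (DstarList_univ_le x₀ _ _).trans ?_
  have := hlen x hx
  have := hlen y hy
  norm_cast
  omega

/-- Two nearby words in annuli of the same parity lie in the same piece. -/
theorem annulusPiece_eq_of_Dstar_le {X : Type u} (E : Set (X × X)) {x₀ : X} {n k k' : ℕ}
    {p p' : List X} {x y : FreeWord X x₀} (hx : x ∈ annulusPiece x₀ (n + 1) k p)
    (hy : y ∈ annulusPiece x₀ (n + 1) k' p') (hk : k % 2 = k' % 2)
    (h : Dstar E x₀ x y ≤ n) : k = k' ∧ p = p' := by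
  obtain ⟨q, s, t, hxq, hyq, hs, ht⟩ := exists_prefix_of_DstarList_le E x.2 y.2 h
  obtain ⟨rfl, rfl⟩ := hx
  obtain ⟨rfl, rfl⟩ := hy
  have hlx : x.1.length = q.length + s.length := by rw [hxq, List.length_append]
  have hly : y.1.length = q.length + t.length := by rw [hyq, List.length_append]
  have hle : x.1.length / (n + 1) ≤ y.1.length / (n + 1) + 1 := by
    rw [← Nat.add_div_right _ n.succ_pos]
    exact Nat.div_le_div_right (by omega)
  have hge : y.1.length / (n + 1) ≤ x.1.length / (n + 1) + 1 := by
    rw [← Nat.add_div_right _ n.succ_pos]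
    exact Nat.div_le_div_right (by omega)
  have hkk : x.1.length / (n + 1) = y.1.length / (n + 1) := by omega
  refine ⟨hkk, ?_⟩
  rw [← hkk]
  have hq : (x.1.length / (n + 1) - 1) * (n + 1) ≤ q.length := by
    rw [Nat.sub_mul]
    have := Nat.div_mul_le_self x.1.length (n + 1)
    omega
  generalize (x.1.length / (n + 1) - 1) * (n + 1) = m at hq ⊢
  rw [hxq, hyq, List.take_append_of_le_length hq, List.take_append_of_le_length hq]

/-- If `(B,𝓔)` is a coarse space in which `B × B` is an entourage, then the coarse free
product satisfies `asdim ∗B ≤ 1`. -/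
theorem asdim_free_product_of_bounded
    {B : Type u} (𝓔 : Set (Set (B × B))) (h𝓔 : IsCoarseStructure 𝓔) (x₀ : B)
    (hB : (Set.univ : Set (B × B)) ∈ 𝓔) :
    AsdimLE (freeEnts 𝓔 x₀) 1 := by
  rintro L ⟨E, -, n, hL⟩
  refine ⟨bracket univ x₀ (4 * (n + 1)), ⟨univ, hB, _, subset_rfl⟩,
    fun i => {V | ∃ k p, k % 2 = i.1 ∧ V = annulusPiece x₀ (n + 1) k p}, ?_, ?_, ?_⟩
  · exact fun y => ⟨⟨y.1.length / (n + 1) % 2, Nat.mod_lt _ two_pos⟩, _, ⟨_, _, rfl, rfl⟩,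
      rfl, rfl⟩
  · rintro i _ ⟨k, p, hk, rfl⟩ _ ⟨k', p', hk', rfl⟩ hne x hx y hy hxy
    obtain ⟨rfl, rfl⟩ := annulusPiece_eq_of_Dstar_le E hx hy (hk.trans hk'.symm) (hL hxy)
    exact hne rfl
  · rintro i _ ⟨k, p, -, rfl⟩ x hx y hy
    exact Dstar_univ_le_of_mem_annulusPiece n.succ_pos hx hy
end

section
/- Suppose (X,d) is a metric space with basepoint x₀. Then the coarse free product structure ∗𝓑_d on ∗X is contained in the bounded coarse structure 𝓑_{d*} of the free-product metric d*: that is, ∗𝓑_d ⊆ 𝓑_{d*}. -/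
open Set

universe u v

/-- The bounded coarse structure of a metric space: subsets of `X × X` on which the
distance is bounded. -/
def metricBoundedCoarse (X : Type u) [PseudoMetricSpace X] : Set (Set (X × X)) :=
  {E | ∃ R : ℝ, ∀ p ∈ E, dist p.1 p.2 ≤ R}

open Classical in
/-- The free-product metric `d*` on underlying lists:
`d*(a·b·x₁⋯x_n, a·b'·x'₁⋯x'_m) = d(b,b') + Σ d(xᵢ,x₀) + Σ d(x'ⱼ,x₀)`. -/
noncomputable def dstarList {X : Type u} [PseudoMetricSpace X] (x₀ : X) :
    List X → List X → ℝ
  | [], [] => 0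
  | [], b :: t => dist x₀ b + (t.map fun c => dist c x₀).sum
  | a :: s, [] => dist a x₀ + (s.map fun c => dist c x₀).sum
  | a :: s, b :: t =>
      if a = b then dstarList x₀ s t
      else dist a b + (s.map fun c => dist c x₀).sum + (t.map fun c => dist c x₀).sum

/-- The free-product metric `d*` on `∗X`. -/
noncomputable def dstar {X : Type u} [PseudoMetricSpace X] (x₀ : X)
    (x y : FreeWord X x₀) : ℝ :=
  dstarList x₀ x.1 y.1

/-- The bounded coarse structure `𝓑_{d*}` on `∗X` associated to the free-product
metric `d*`. -/
def metricFreeBounded (X : Type u) [PseudoMetricSpace X] (x₀ : X) :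
    Set (Set (FreeWord X x₀ × FreeWord X x₀)) :=
  {E | ∃ R : ℝ, ∀ p ∈ E, dstar x₀ p.1 p.2 ≤ R}

section Bounded

variable {X : Type u} [PseudoMetricSpace X] {E : Set (X × X)} {R : ℝ}

/-- A pair in the `k`-fold composition of an `R`-bounded relation is at distance at most `R * k`. -/
theorem dist_le_of_mem_compIter (hE : ∀ p ∈ E, dist p.1 p.2 ≤ R) (k : ℕ) (x y : X)
    (h : (x, y) ∈ compIter E k) : dist x y ≤ R * k := by
  induction k generalizing x with
  | zero =>
    obtain rfl : x = y := h.2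
    simp
  | succ k ih =>
    cases k with
    | zero => simpa using hE _ h
    | succ k =>
      obtain ⟨z, hxz, hzy⟩ := h
      have hle : dist x z ≤ R := hE _ hxz
      have hrest := ih z hzy
      have htri := dist_triangle x z y
      push_cast at hrest ⊢
      linarith

theorem mem_compIter_of_DE_eq_coe {Y : Type u} {F : Set (Y × Y)} {x y : Y} {k : ℕ}
    (h : DE F x y = k) : (x, y) ∈ compIter F k := by
  have hne : {n : ℕ∞ | ∃ k : ℕ, n = (k : ℕ∞) ∧ (x, y) ∈ compIter F k}.Nonempty := by
    by_contra hempty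
    rw [Set.not_nonempty_iff_eq_empty] at hempty
    rw [DE, hempty, sInf_empty] at h
    exact ENat.top_ne_natCast k h
  obtain ⟨m, hm, hmem⟩ := csInf_mem hne
  obtain rfl : k = m := by exact_mod_cast h.symm.trans hm
  exact hmem

theorem dist_le_of_DE_eq_coe (hE : ∀ p ∈ E, dist p.1 p.2 ≤ R) {x y : X} {k : ℕ}
    (h : DE E x y = k) : dist x y ≤ R * k :=
  dist_le_of_mem_compIter hE k x y (mem_compIter_of_DE_eq_coe h)

theorem ENat.exists_coe_of_add_eq_coe {a b : ℕ∞} {n : ℕ} (h : a + b = n) :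
    ∃ p q : ℕ, a = p ∧ b = q ∧ p + q = n := by
  obtain ⟨p, q, hp, hq, hpq⟩ := WithTop.add_eq_coe.mp h
  exact ⟨p, q, hp.symm, hq.symm, hpq⟩

theorem sum_dist_le_of_sum_eq_coe (x₀ : X) {f : X → ℕ∞}
    (hf : ∀ (a : X) (k : ℕ), f a = k → dist a x₀ ≤ R * k) (l : List X) (n : ℕ)
    (h : (l.map f).sum = n) : (l.map fun c => dist c x₀).sum ≤ R * n := by
  induction l generalizing n with
  | nil =>
    rw [List.map_nil, List.sum_nil] at h
    obtain rfl : n = 0 := by exact_mod_cast h.symm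
    simp
  | cons a l ih =>
    rw [List.map_cons, List.sum_cons] at h
    obtain ⟨p, q, hp, hq, rfl⟩ := ENat.exists_coe_of_add_eq_coe h
    rw [List.map_cons, List.sum_cons]
    have ha := hf a p hp
    have hl := ih q hq
    push_cast
    linarith

theorem sum_dist_le_of_wnormL_eq_coe (hE : ∀ p ∈ E, dist p.1 p.2 ≤ R) (x₀ : X) {l : List X}
    {n : ℕ} (h : wnormL E x₀ l = n) : (l.map fun c => dist c x₀).sum ≤ R * n :=
  sum_dist_le_of_sum_eq_coe x₀
    (fun a _ ha => dist_comm x₀ a ▸ dist_le_of_DE_eq_coe hE ha) l n h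

theorem sum_dist_le_of_wnormR_eq_coe (hE : ∀ p ∈ E, dist p.1 p.2 ≤ R) (x₀ : X) {l : List X}
    {n : ℕ} (h : wnormR E x₀ l = n) : (l.map fun c => dist c x₀).sum ≤ R * n :=
  sum_dist_le_of_sum_eq_coe x₀ (fun _ _ ha => dist_le_of_DE_eq_coe hE ha) l n h

/-- The free-product metric is at most `R` times `D*_E` when `E` is `R`-bounded. -/
theorem dstarList_le_of_DstarList_eq_coe (hE : ∀ p ∈ E, dist p.1 p.2 ≤ R) (x₀ : X)
    (l l' : List X) (n : ℕ) (h : DstarList E x₀ l l' = n) : dstarList x₀ l l' ≤ R * n := by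
  induction l generalizing l' with
  | nil =>
    cases l' with
    | nil =>
      obtain rfl : n = 0 := by
        rw [DstarList] at h
        exact_mod_cast h.symm
      simp [dstarList]
    | cons b t =>
      rw [DstarList] at h
      obtain ⟨p, q, hp, hq, rfl⟩ := ENat.exists_coe_of_add_eq_coe h
      have hb := dist_le_of_DE_eq_coe hE hp
      have ht := sum_dist_le_of_wnormR_eq_coe hE x₀ hq
      rw [dstarList]
      push_cast
      linarith
  | cons a s ih =>
    cases l' with
    | nil =>
      rw [DstarList] at h
      obtain ⟨p, q, hp, hq, rfl⟩ := ENat.exists_coe_of_add_eq_coe h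
      have ha := dist_le_of_DE_eq_coe hE hp
      have hs := sum_dist_le_of_wnormL_eq_coe hE x₀ hq
      rw [dstarList]
      push_cast
      linarith
    | cons b t =>
      rw [DstarList] at h
      rw [dstarList]
      split_ifs at h ⊢ with hab
      · exact ih t h
      · obtain ⟨m, r, hm, hr, rfl⟩ := ENat.exists_coe_of_add_eq_coe h
        obtain ⟨p, q, hp, hq, rfl⟩ := ENat.exists_coe_of_add_eq_coe hm
        have hdist := dist_le_of_DE_eq_coe hE hp
        have hs := sum_dist_le_of_wnormL_eq_coe hE x₀ hq
        have ht := sum_dist_le_of_wnormR_eq_coe hE x₀ hr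
        push_cast
        linarith

end Bounded

/-- For a metric space `(X,d)`, the coarse free product structure `∗𝓑_d` is contained in
the bounded coarse structure `𝓑_{d*}` of the free-product metric. -/
theorem freeEnts_subset_metricFreeBounded
    {X : Type u} [MetricSpace X] (x₀ : X) :
    freeEnts (metricBoundedCoarse X) x₀ ⊆ metricFreeBounded X x₀ := by
  rintro L ⟨E, ⟨R, hE⟩, n, hL⟩
  refine ⟨max R 0 * n, fun p hp => ?_⟩
  obtain ⟨m, hm, hmn⟩ := ENat.le_natCast_iff.mp (hL hp)
  calc dstar x₀ p.1 p.2 ≤ max R 0 * m :=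
        dstarList_le_of_DstarList_eq_coe (fun q hq => (hE q hq).trans (le_max_left R 0))
          x₀ p.1.1 p.2.1 m hm
    _ ≤ max R 0 * n := by gcongr
end

section
/- Suppose (X,d) is a uniformly discrete metric space (i.e. inf{d(y,y') : y ≠ y' ∈ X} > 0) with basepoint x₀. Then the coarse free product structure equals the bounded coarse structure of the free-product metric: ∗𝓑_d = 𝓑_{d*}. -/
open Set

universe u v

theorem ENat.exists_nat_add_of_add_le {a b : ℕ∞} {n : ℕ} (h : a + b ≤ n) :
    ∃ p q : ℕ, a = p ∧ b = q ∧ p + q ≤ n := by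
  have hne : a + b ≠ ⊤ := ne_top_of_le_ne_top (ENat.natCast_ne_top n) h
  rw [Ne, ENat.add_eq_top, not_or] at hne
  lift a to ℕ using hne.1
  lift b to ℕ using hne.2
  exact ⟨a, b, rfl, rfl, by exact_mod_cast h⟩

theorem List.sum_map_le_mul_of_sum_map_le {X : Type u} {f : X → ℕ∞} {g : X → ℝ} {R : ℝ}
    (hR : 0 ≤ R) (hfg : ∀ a, ∀ n : ℕ, f a ≤ n → g a ≤ n * R) (l : List X) (n : ℕ)
    (h : (l.map f).sum ≤ n) : (l.map g).sum ≤ n * R := by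
  induction l generalizing n with
  | nil => simpa using by positivity
  | cons a l ih =>
    simp only [List.map_cons, List.sum_cons] at h ⊢
    obtain ⟨p, q, hp, hq, hpq⟩ := ENat.exists_nat_add_of_add_le h
    have hpq' : (p : ℝ) + q ≤ n := by exact_mod_cast hpq
    nlinarith [hfg a p hp.le, ih q hq.le]

theorem DE_le_one_of_mem {X : Type u} {E : Set (X × X)} {x y : X} (h : (x, y) ∈ E) :
    DE E x y ≤ 1 :=
  sInf_le ⟨1, by simp, h⟩

section ToMetric

variable {X : Type u} [PseudoMetricSpace X] {E : Set (X × X)} {R : ℝ}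

theorem dist_le_mul_of_mem_compIter (hE : ∀ p ∈ E, dist p.1 p.2 ≤ R) {k : ℕ} {x y : X}
    (h : (x, y) ∈ compIter E k) : dist x y ≤ k * R := by
  induction k using Nat.twoStepInduction generalizing x with
  | zero =>
    obtain rfl : x = y := h.2
    simp
  | one => simpa using hE _ h
  | more k _ ih =>
    obtain ⟨z, hz, hzy⟩ := h
    have h₁ := hE _ hz
    have h₂ := ih hzy
    have h₃ := dist_triangle x z y
    push_cast at h₂ ⊢
    linarith

theorem dist_le_mul_of_DE_le (hR : 0 ≤ R) (hE : ∀ p ∈ E, dist p.1 p.2 ≤ R) {x y : X} {n : ℕ}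
    (h : DE E x y ≤ n) : dist x y ≤ n * R := by
  have hne : {n : ℕ∞ | ∃ k : ℕ, n = (k : ℕ∞) ∧ (x, y) ∈ compIter E k}.Nonempty := by
    by_contra hempty
    rw [DE, Set.not_nonempty_iff_eq_empty.mp hempty, sInf_empty] at h
    exact ENat.natCast_ne_top n (top_le_iff.mp h)
  obtain ⟨k, hk, hmem⟩ := csInf_mem hne
  have hkn : k ≤ n := by
    rw [DE, hk] at h
    exact_mod_cast h
  exact (dist_le_mul_of_mem_compIter hE hmem).trans (by gcongr)

theorem dstarList_le_mul_of_DstarList_le (hR : 0 ≤ R) (hE : ∀ p ∈ E, dist p.1 p.2 ≤ R) (x₀ : X)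
    (l l' : List X) (n : ℕ) (h : DstarList E x₀ l l' ≤ n) :
    dstarList x₀ l l' ≤ n * R := by
  have hL : ∀ (l : List X) (n : ℕ), wnormL E x₀ l ≤ n →
      (l.map fun c => dist c x₀).sum ≤ n * R :=
    List.sum_map_le_mul_of_sum_map_le hR fun a n ha => by
      rw [dist_comm]; exact dist_le_mul_of_DE_le hR hE ha
  have hR' : ∀ (l : List X) (n : ℕ), wnormR E x₀ l ≤ n →
      (l.map fun c => dist c x₀).sum ≤ n * R :=
    List.sum_map_le_mul_of_sum_map_le hR fun a n ha => dist_le_mul_of_DE_le hR hE ha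
  induction l generalizing l' with
  | nil =>
    cases l' with
    | nil => simpa [dstarList] using by positivity
    | cons b t =>
      simp only [DstarList, dstarList] at h ⊢
      obtain ⟨p, q, hp, hq, hpq⟩ := ENat.exists_nat_add_of_add_le h
      have hpq' : (p : ℝ) + q ≤ n := by exact_mod_cast hpq
      nlinarith [dist_le_mul_of_DE_le hR hE hp.le, hR' t q hq.le]
  | cons a s ih =>
    cases l' with
    | nil =>
      simp only [DstarList, dstarList] at h ⊢
      obtain ⟨p, q, hp, hq, hpq⟩ := ENat.exists_nat_add_of_add_le h
      have hpq' : (p : ℝ) + q ≤ n := by exact_mod_cast hpq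
      nlinarith [dist_le_mul_of_DE_le hR hE hp.le, hL s q hq.le]
    | cons b t =>
      simp only [DstarList, dstarList] at h ⊢
      split_ifs at h ⊢
      · exact ih t h
      · obtain ⟨m, k, hm, hk, hmk⟩ := ENat.exists_nat_add_of_add_le h
        obtain ⟨p, q, hp, hq, hpq⟩ := ENat.exists_nat_add_of_add_le hm.le
        have hsum : (p : ℝ) + q + k ≤ n := by exact_mod_cast (by omega : p + q + k ≤ n)
        nlinarith [dist_le_mul_of_DE_le hR hE hp.le, hL s q hq.le, hR' t k hk.le]

end ToMetric

section OfMetric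

variable {X : Type u} [PseudoMetricSpace X] {x₀ : X} {r R : ℝ}

theorem sum_map_dist_nonneg (x₀ : X) (l : List X) : 0 ≤ (l.map fun c => dist c x₀).sum :=
  List.sum_nonneg (by simp)

theorem dist_le_of_sum_map_dist_le {l : List X} (h : (l.map fun c => dist c x₀).sum ≤ R)
    {c : X} (hc : c ∈ l) : dist c x₀ ≤ R :=
  (List.single_le_sum (by simp) _ (List.mem_map_of_mem hc)).trans h

theorem length_mul_le_sum_map_dist (hud : ∀ y y' : X, y ≠ y' → r ≤ dist y y') {l : List X}
    (hl : x₀ ∉ l) : l.length * r ≤ (l.map fun c => dist c x₀).sum := by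
  have h := List.card_nsmul_le_sum (l.map fun c => dist c x₀) r (by
    simp only [List.mem_map, forall_exists_index, and_imp, forall_apply_eq_imp_iff₂]
    exact fun c hc => hud c x₀ fun hcx => hl (hcx ▸ hc))
  simpa using h

theorem wnormL_le_length_s11 {l : List X} (h : (l.map fun c => dist c x₀).sum ≤ R) :
    wnormL {p : X × X | dist p.1 p.2 ≤ R} x₀ l ≤ l.length := by
  have := List.sum_le_card_nsmul (l.map fun c => DE {p : X × X | dist p.1 p.2 ≤ R} x₀ c) 1 (by
    simp only [List.mem_map, forall_exists_index, and_imp, forall_apply_eq_imp_iff₂]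
    exact fun c hc => DE_le_one_of_mem
      ((dist_comm x₀ c).trans_le (dist_le_of_sum_map_dist_le h hc)))
  simpa [wnormL] using this

theorem wnormR_le_length_s11 {l : List X} (h : (l.map fun c => dist c x₀).sum ≤ R) :
    wnormR {p : X × X | dist p.1 p.2 ≤ R} x₀ l ≤ l.length := by
  have := List.sum_le_card_nsmul (l.map fun c => DE {p : X × X | dist p.1 p.2 ≤ R} c x₀) 1 (by
    simp only [List.mem_map, forall_exists_index, and_imp, forall_apply_eq_imp_iff₂]
    exact fun c hc => DE_le_one_of_mem (dist_le_of_sum_map_dist_le h hc))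
  simpa [wnormR] using this

theorem DstarList_le_of_dstarList_le (hr : 0 < r) (hud : ∀ y y' : X, y ≠ y' → r ≤ dist y y')
    (l l' : List X) (hl : x₀ ∉ l) (hl' : x₀ ∉ l') (h : dstarList x₀ l l' ≤ R) :
    DstarList {p : X × X | dist p.1 p.2 ≤ R} x₀ l l' ≤ (1 + ⌈R / r⌉₊ : ℕ) := by
  have hlen : ∀ m : ℕ, m * r ≤ R → m ≤ ⌈R / r⌉₊ := fun m hm =>
    Nat.cast_le.mp (((le_div_iff₀ hr).mpr hm).trans (Nat.le_ceil _))
  induction l generalizing l' with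
  | nil =>
    cases l' with
    | nil => simp [DstarList]
    | cons b t =>
      simp only [List.mem_cons, not_or] at hl'
      simp only [DstarList, dstarList] at h ⊢
      have ht := sum_map_dist_nonneg x₀ t
      have htr := length_mul_le_sum_map_dist hud hl'.2
      have hd : 0 ≤ dist x₀ b := dist_nonneg
      push_cast
      refine add_le_add (DE_le_one_of_mem (by simp only [mem_ofPred_eq]; linarith))
        ((wnormR_le_length_s11 (by linarith)).trans ?_)
      exact_mod_cast hlen _ (by linarith)
  | cons a s ih =>
    simp only [List.mem_cons, not_or] at hl
    have hs := sum_map_dist_nonneg x₀ s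
    have hsr := length_mul_le_sum_map_dist hud hl.2
    cases l' with
    | nil =>
      simp only [DstarList, dstarList] at h ⊢
      have hd : 0 ≤ dist a x₀ := dist_nonneg
      push_cast
      refine add_le_add (DE_le_one_of_mem (by simp only [mem_ofPred_eq]; linarith))
        ((wnormL_le_length_s11 (by linarith)).trans ?_)
      exact_mod_cast hlen _ (by linarith)
    | cons b t =>
      simp only [List.mem_cons, not_or] at hl'
      simp only [DstarList, dstarList] at h ⊢
      split_ifs at h ⊢
      · exact ih t hl.2 hl'.2 h
      · have ht := sum_map_dist_nonneg x₀ t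
        have htr := length_mul_le_sum_map_dist hud hl'.2
        have hd : 0 ≤ dist a b := dist_nonneg
        rw [add_assoc]
        push_cast
        refine add_le_add (DE_le_one_of_mem (by simp only [mem_ofPred_eq]; linarith))
          ((add_le_add (wnormL_le_length_s11 (by linarith)) (wnormR_le_length_s11 (by linarith))).trans ?_)
        exact_mod_cast hlen (s.length + t.length) (by push_cast; linarith)

end OfMetric

/-- For a uniformly discrete metric space `(X,d)`, the coarse free product structure
equals the bounded coarse structure of the free-product metric: `∗𝓑_d = 𝓑_{d*}`. -/
theorem freeEnts_eq_metricFreeBounded_of_uniformly_discrete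
    {X : Type u} [MetricSpace X] (x₀ : X)
    (hud : ∃ r : ℝ, 0 < r ∧ ∀ y y' : X, y ≠ y' → r ≤ dist y y') :
    freeEnts (metricBoundedCoarse X) x₀ = metricFreeBounded X x₀ := by
  obtain ⟨r, hr, hud⟩ := hud
  ext L
  constructor
  · rintro ⟨E, ⟨R, hE⟩, n, hL⟩
    exact ⟨n * max R 0, fun p hp => dstarList_le_mul_of_DstarList_le (le_max_right R 0)
      (fun q hq => (hE q hq).trans (le_max_left R 0)) x₀ _ _ n (hL hp)⟩
  · rintro ⟨R, hL⟩
    exact ⟨{p | dist p.1 p.2 ≤ R}, ⟨R, fun _ hp => hp⟩, 1 + ⌈R / r⌉₊, fun p hp =>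
      DstarList_le_of_dstarList_le hr hud _ _ p.1.2 p.2.2 (hL p hp)⟩
end

section
/- Let (X,𝓔) be a coarse space with basepoint x₀ and let E ∈ 𝓔 be symmetric (E = E⁻¹). Then D*_E is an ∞-metric on ∗X: D*_E(x,x') = 0 if and only if x = x'; D*_E(x,x') = D*_E(x',x) for all x, x' ∈ ∗X; and D*_E(x,y) ≤ D*_E(x,z) + D*_E(z,y) for all x, y, z ∈ ∗X (with values in ℕ ∪ {∞}). -/
open Set

universe u v

section EntourageDistance

variable {X : Type u} {E : Set (X × X)} {x₀ : X}

theorem compIter_trans {k l : ℕ} {a b c : X} (hab : (a, b) ∈ compIter E k)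
    (hbc : (b, c) ∈ compIter E l) : (a, c) ∈ compIter E (k + l) := by
  induction k using Nat.twoStepInduction generalizing a with
  | zero =>
    obtain rfl : a = b := hab.2
    simpa using hbc
  | one =>
    match l, hbc with
    | 0, hbc =>
      obtain rfl : b = c := hbc.2
      exact hab
    | l + 1, hbc =>
      rw [show 1 + (l + 1) = l + 2 by omega]
      exact ⟨b, hab, hbc⟩
  | more k _ ih =>
    obtain ⟨w, haw, hwb⟩ := hab
    have h := ih hwb
    rw [show k + 1 + l = k + l + 1 by omega] at h
    rw [show k + 2 + l = k + l + 2 by omega]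
    exact ⟨w, haw, h⟩

theorem compIter_symm (hsymm : ∀ a b : X, (a, b) ∈ E ↔ (b, a) ∈ E) {k : ℕ} {a b : X}
    (h : (a, b) ∈ compIter E k) : (b, a) ∈ compIter E k := by
  induction k using Nat.twoStepInduction generalizing a with
  | zero => exact ⟨(hsymm _ _).1 h.1, h.2.symm⟩
  | one => exact (hsymm _ _).1 h
  | more k _ ih =>
    obtain ⟨w, haw, hwb⟩ := h
    exact compIter_trans (l := 1) (ih hwb) ((hsymm _ _).1 haw)

theorem DE_le {k : ℕ} {a b : X} (h : (a, b) ∈ compIter E k) : DE E a b ≤ k :=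
  sInf_le ⟨k, rfl, h⟩

theorem exists_compIter_of_DE_ne_top {a b : X} (h : DE E a b ≠ ⊤) :
    ∃ k : ℕ, DE E a b = k ∧ (a, b) ∈ compIter E k := by
  refine csInf_mem (s := {n : ℕ∞ | ∃ k : ℕ, n = (k : ℕ∞) ∧ (a, b) ∈ compIter E k}) ?_
  by_contra hempty
  rw [Set.not_nonempty_iff_eq_empty] at hempty
  exact h (by rw [DE, hempty, sInf_empty])

theorem eq_of_DE_eq_zero {a b : X} (h : DE E a b = 0) : a = b := by
  obtain ⟨k, hk, hab⟩ := exists_compIter_of_DE_ne_top (E := E) (a := a) (b := b) (by simp [h])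
  obtain rfl : k = 0 := by exact_mod_cast hk.symm.trans h
  exact hab.2

theorem DE_comm (hsymm : ∀ a b : X, (a, b) ∈ E ↔ (b, a) ∈ E) (a b : X) :
    DE E a b = DE E b a := by
  have h (a b : X) (k : ℕ) : (a, b) ∈ compIter E k ↔ (b, a) ∈ compIter E k :=
    ⟨compIter_symm hsymm, compIter_symm hsymm⟩
  simp only [DE, h a b]

theorem DE_triangle (a b c : X) : DE E a c ≤ DE E a b + DE E b c := by
  by_cases h₁ : DE E a b = ⊤
  · simp [h₁]
  by_cases h₂ : DE E b c = ⊤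
  · simp [h₂]
  obtain ⟨k, hk, hab⟩ := exists_compIter_of_DE_ne_top h₁
  obtain ⟨l, hl, hbc⟩ := exists_compIter_of_DE_ne_top h₂
  rw [hk, hl]
  exact_mod_cast DE_le (compIter_trans hab hbc)

theorem wnormR_eq_wnormL (hsymm : ∀ a b : X, (a, b) ∈ E ↔ (b, a) ∈ E) (x₀ : X) (l : List X) :
    wnormR E x₀ l = wnormL E x₀ l := by
  simp only [wnormR, wnormL, DE_comm hsymm x₀]

theorem wnormL_cons (a : X) (s : List X) :
    wnormL E x₀ (a :: s) = DE E x₀ a + wnormL E x₀ s := by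
  simp [wnormL]

theorem DstarList_nil_left (hsymm : ∀ a b : X, (a, b) ∈ E ↔ (b, a) ∈ E) (t : List X) :
    DstarList E x₀ [] t = wnormL E x₀ t := by
  cases t with
  | nil => simp [DstarList, wnormL]
  | cons b t => simp [DstarList, wnormR_eq_wnormL hsymm, wnormL_cons]

theorem DstarList_nil_right (hsymm : ∀ a b : X, (a, b) ∈ E ↔ (b, a) ∈ E) (s : List X) :
    DstarList E x₀ s [] = wnormL E x₀ s := by
  cases s with
  | nil => simp [DstarList, wnormL]
  | cons a s => simp [DstarList, DE_comm hsymm a, wnormL_cons]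

theorem DstarList_cons_self (a : X) (s t : List X) :
    DstarList E x₀ (a :: s) (a :: t) = DstarList E x₀ s t := by
  simp [DstarList]

theorem DstarList_cons_of_ne (hsymm : ∀ a b : X, (a, b) ∈ E ↔ (b, a) ∈ E) {a b : X}
    (hab : a ≠ b) (s t : List X) :
    DstarList E x₀ (a :: s) (b :: t) = DE E a b + wnormL E x₀ s + wnormL E x₀ t := by
  simp [DstarList, hab, wnormR_eq_wnormL hsymm]

theorem DstarList_comm (hsymm : ∀ a b : X, (a, b) ∈ E ↔ (b, a) ∈ E) (s t : List X) :
    DstarList E x₀ s t = DstarList E x₀ t s := by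
  induction s generalizing t with
  | nil => rw [DstarList_nil_left hsymm, DstarList_nil_right hsymm]
  | cons a s ih =>
    cases t with
    | nil => rw [DstarList_nil_left hsymm, DstarList_nil_right hsymm]
    | cons b t =>
      by_cases hab : a = b
      · subst hab
        rw [DstarList_cons_self, DstarList_cons_self, ih]
      · rw [DstarList_cons_of_ne hsymm hab, DstarList_cons_of_ne hsymm (Ne.symm hab),
          DE_comm hsymm a b, add_right_comm]

theorem DstarList_self (s : List X) : DstarList E x₀ s s = 0 := by
  induction s with
  | nil => simp [DstarList]
  | cons a s ih => rw [DstarList_cons_self, ih]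

theorem eq_of_DstarList_eq_zero {s t : List X} (hs : x₀ ∉ s) (ht : x₀ ∉ t)
    (h : DstarList E x₀ s t = 0) : s = t := by
  induction s generalizing t with
  | nil =>
    cases t with
    | nil => rfl
    | cons b t =>
      simp only [DstarList, add_eq_zero] at h
      exact absurd (eq_of_DE_eq_zero h.1) (by simp_all)
  | cons a s ih =>
    cases t with
    | nil =>
      simp only [DstarList, add_eq_zero] at h
      exact absurd (eq_of_DE_eq_zero h.1).symm (by simp_all)
    | cons b t =>
      by_cases hab : a = b
      · subst hab
        rw [DstarList_cons_self] at h
        rw [ih (fun h' => hs (by simp [h'])) (fun h' => ht (by simp [h'])) h]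
      · simp only [DstarList, hab, if_false, add_eq_zero] at h
        exact absurd (eq_of_DE_eq_zero h.1.1) hab

theorem DstarList_le_wnormL_add (hsymm : ∀ a b : X, (a, b) ∈ E ↔ (b, a) ∈ E)
    (s t : List X) : DstarList E x₀ s t ≤ wnormL E x₀ s + wnormL E x₀ t := by
  induction s generalizing t with
  | nil => rw [DstarList_nil_left hsymm]; exact le_add_self
  | cons a s ih =>
    cases t with
    | nil => rw [DstarList_nil_right hsymm]; exact le_self_add
    | cons b t =>
      rw [wnormL_cons, wnormL_cons]
      by_cases hab : a = b
      · subst hab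
        rw [DstarList_cons_self]
        exact (ih t).trans (add_le_add le_add_self le_add_self)
      · rw [DstarList_cons_of_ne hsymm hab]
        calc DE E a b + wnormL E x₀ s + wnormL E x₀ t
            ≤ (DE E a x₀ + DE E x₀ b) + wnormL E x₀ s + wnormL E x₀ t := by
              gcongr; exact DE_triangle _ _ _
          _ = _ := by rw [DE_comm hsymm a]; ring

theorem wnormL_le_add_DstarList (hsymm : ∀ a b : X, (a, b) ∈ E ↔ (b, a) ∈ E)
    (s t : List X) : wnormL E x₀ t ≤ wnormL E x₀ s + DstarList E x₀ s t := by
  induction s generalizing t with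
  | nil => rw [DstarList_nil_left hsymm]; exact le_add_self
  | cons a s ih =>
    cases t with
    | nil => simp [wnormL]
    | cons b t =>
      rw [wnormL_cons, wnormL_cons]
      by_cases hab : a = b
      · subst hab
        rw [DstarList_cons_self, add_assoc]
        gcongr
        exact ih t
      · rw [DstarList_cons_of_ne hsymm hab]
        calc DE E x₀ b + wnormL E x₀ t
            ≤ (DE E x₀ a + DE E a b) + wnormL E x₀ t := by
              gcongr; exact DE_triangle _ _ _
          _ ≤ (DE E x₀ a + DE E a b) + wnormL E x₀ t + (wnormL E x₀ s + wnormL E x₀ s) :=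
              le_self_add
          _ = _ := by ring

theorem DstarList_triangle (hsymm : ∀ a b : X, (a, b) ∈ E ↔ (b, a) ∈ E) (s t r : List X) :
    DstarList E x₀ s t ≤ DstarList E x₀ s r + DstarList E x₀ r t := by
  induction s generalizing t r with
  | nil =>
    rw [DstarList_nil_left hsymm, DstarList_nil_left hsymm]
    exact wnormL_le_add_DstarList hsymm r t
  | cons a s ih =>
    cases t with
    | nil =>
      rw [DstarList_nil_right hsymm, DstarList_nil_right hsymm, add_comm,
        DstarList_comm hsymm _ r]
      exact wnormL_le_add_DstarList hsymm r _
    | cons b t =>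
      cases r with
      | nil =>
        rw [DstarList_nil_right hsymm, DstarList_nil_left hsymm]
        exact DstarList_le_wnormL_add hsymm _ _
      | cons c r =>
        by_cases hac : a = c
        · subst hac
          rw [DstarList_cons_self]
          by_cases hab : a = b
          · subst hab
            rw [DstarList_cons_self, DstarList_cons_self]
            exact ih t r
          · rw [DstarList_cons_of_ne hsymm hab, DstarList_cons_of_ne hsymm hab,
              DstarList_comm hsymm s]
            calc DE E a b + wnormL E x₀ s + wnormL E x₀ t
                ≤ DE E a b + (wnormL E x₀ r + DstarList E x₀ r s) + wnormL E x₀ t := by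
                  gcongr; exact wnormL_le_add_DstarList hsymm _ _
              _ = _ := by ring
        · rw [DstarList_cons_of_ne hsymm hac]
          by_cases hcb : c = b
          · subst hcb
            rw [DstarList_cons_self, DstarList_cons_of_ne hsymm hac, add_assoc _ (wnormL E x₀ r)]
            gcongr
            exact wnormL_le_add_DstarList hsymm r t
          · rw [DstarList_cons_of_ne hsymm hcb]
            have hle : DE E a c + DE E c b + wnormL E x₀ s + wnormL E x₀ t ≤
                DE E a c + wnormL E x₀ s + wnormL E x₀ r +
                  (DE E c b + wnormL E x₀ r + wnormL E x₀ t) :=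
              calc _ ≤ DE E a c + DE E c b + wnormL E x₀ s + wnormL E x₀ t +
                    (wnormL E x₀ r + wnormL E x₀ r) := le_self_add
                _ = _ := by ring
            refine le_trans ?_ hle
            by_cases hab : a = b
            · subst hab
              rw [DstarList_cons_self, add_assoc]
              exact (DstarList_le_wnormL_add hsymm s t).trans le_add_self
            · rw [DstarList_cons_of_ne hsymm hab]
              gcongr
              exact DE_triangle _ _ _

end EntourageDistance

/-- For a symmetric entourage `E`, `D*_E` is an `∞`-metric on `∗X`. -/
theorem Dstar_infty_metric
    {X : Type u} (𝓔 : Set (Set (X × X))) (h𝓔 : IsCoarseStructure 𝓔) (x₀ : X)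
    (E : Set (X × X)) (hE : E ∈ 𝓔)
    (hsymm : ∀ a b : X, (a, b) ∈ E ↔ (b, a) ∈ E) :
    (∀ x y : FreeWord X x₀, Dstar E x₀ x y = 0 ↔ x = y) ∧
    (∀ x y : FreeWord X x₀, Dstar E x₀ x y = Dstar E x₀ y x) ∧
    (∀ x y z : FreeWord X x₀, Dstar E x₀ x y ≤ Dstar E x₀ x z + Dstar E x₀ z y) := by
  refine ⟨fun x y => ⟨fun h => Subtype.ext (eq_of_DstarList_eq_zero x.2 y.2 h), ?_⟩,
    fun x y => DstarList_comm hsymm x.1 y.1, fun x y z => DstarList_triangle hsymm x.1 y.1 z.1⟩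
  rintro rfl
  exact DstarList_self x.1
end
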